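/- arXiv:2012.03420 — 3 statements merged into one kernel-verified Lean document; each statement's English description precedes it below -/
import Mathlib

section
/- Let n be a positive natural number, E = EuclideanSpace ℝ (Fin n), and let μ and ν be probability measures on E. Define A = { r : ℝ | ∃ f : E → ℝ, f is differentiable, 1-Lipschitz, integrable with respect to both μ and ν, and r = ∫ f dμ − ∫ f dν }, and B = { r : ℝ | ∃ f : E → ℝ, f is continuously differentiable, integrable with respect to both μ and ν, f satisfies the Sobolev line constraint at (x, y) for every x in the support of μ and every y in the support of ν, and r = ∫ f dμ − ∫ f dν }. If B is bounded above, then sSup A ≤ sSup B. -/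
open MeasureTheory

/-- The Sobolev line constraint at `(x, y)`. -/
def SobolevLineConstraint {n : ℕ} (f : EuclideanSpace ℝ (Fin n) → ℝ)
    (x y : EuclideanSpace ℝ (Fin n)) : Prop :=
  ∫ t in Set.Icc (0 : ℝ) 1, ‖gradient f (t • x + (1 - t) • y)‖ ^ 2 ≤ 1

/-- The topological support of a measure: points all of whose neighborhoods have
nonzero measure. -/
def measureSupport {α : Type*} [TopologicalSpace α] [MeasurableSpace α]
    (μ : Measure α) : Set α :=
  {x | ∀ U ∈ nhds x, μ U ≠ 0}

theorem exists_smooth_approx {n : ℕ} (f : EuclideanSpace ℝ (Fin n) → ℝ)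
    (hf : ∀ u v : EuclideanSpace ℝ (Fin n), |f u - f v| ≤ ‖u - v‖) (δ : ℝ) (hδ : 0 < δ) :
    ∃ g : EuclideanSpace ℝ (Fin n) → ℝ, ContDiff ℝ 1 g ∧
      (∀ u v, |g u - g v| ≤ ‖u - v‖) ∧ ∀ x, |g x - f x| ≤ δ := by
  have hL : LipschitzWith 1 f := LipschitzWith.of_dist_le_mul fun u v => by
    simpa [Real.dist_eq, dist_eq_norm] using hf u v
  have hc : Continuous f := hL.continuous
  let φ : ContDiffBump (0 : EuclideanSpace ℝ (Fin n)) := ⟨δ / 2, δ, by linarith, by linarith⟩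
  let ψ : EuclideanSpace ℝ (Fin n) → ℝ := φ.normed volume
  have hψc : Continuous ψ := φ.continuous_normed
  have hψs : HasCompactSupport ψ := φ.hasCompactSupport_normed
  refine ⟨convolution ψ f (ContinuousLinearMap.lsmul ℝ ℝ) volume, ?_, ?_, ?_⟩
  · exact hψs.contDiff_convolution_left _ φ.contDiff_normed hc.locallyIntegrable
  · intro u v
    have hi : ∀ w, Integrable (fun t => ψ t * f (w - t)) volume := fun w =>
      (hψc.mul (hc.comp (by fun_prop))).integrable_of_hasCompactSupport hψs.mul_right
    simp only [convolution, ContinuousLinearMap.lsmul_apply, smul_eq_mul]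
    rw [← integral_sub (hi u) (hi v), ← Real.norm_eq_abs]
    have h1 : ∫ t, ψ t * ‖u - v‖ = ‖u - v‖ := by
      rw [integral_mul_const]
      have : ∫ t, ψ t = 1 := φ.integral_normed
      rw [this, one_mul]
    refine le_trans (norm_integral_le_of_norm_le (g := fun t => ψ t * ‖u - v‖) ?_ ?_) h1.le
    · exact (hψc.mul continuous_const).integrable_of_hasCompactSupport hψs.mul_right
    · refine Filter.Eventually.of_forall fun t => ?_
      have h0 : 0 ≤ ψ t := φ.nonneg_normed t
      rw [← mul_sub, norm_mul, Real.norm_of_nonneg h0]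
      refine mul_le_mul_of_nonneg_left ?_ h0
      simpa using hf (u - t) (v - t)
  · intro x
    have := φ.dist_normed_convolution_le (μ := volume) (g := f) (x₀ := x) (ε := δ)
      hc.aestronglyMeasurable (fun y hy => by
        have h2 := hL.dist_le_mul y x
        have h3 : dist y x < δ := hy
        simp only [NNReal.coe_one, one_mul] at h2
        linarith)
    rw [← Real.dist_eq]
    exact this

theorem sobolev_of_lipschitz {n : ℕ} (g : EuclideanSpace ℝ (Fin n) → ℝ)
    (hg : ∀ u v : EuclideanSpace ℝ (Fin n), |g u - g v| ≤ ‖u - v‖)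
    (x y : EuclideanSpace ℝ (Fin n)) : SobolevLineConstraint g x y := by
  have hL : LipschitzWith 1 g := LipschitzWith.of_dist_le_mul fun u v => by
    simpa [Real.dist_eq, dist_eq_norm] using hg u v
  have hb : ∀ z, ‖gradient g z‖ ≤ 1 := fun z => by
    have := norm_fderiv_le_of_lipschitz ℝ hL (x₀ := z)
    simpa [gradient] using this
  unfold SobolevLineConstraint
  refine (le_abs_self _).trans ?_
  rw [← Real.norm_eq_abs]
  refine (norm_setIntegral_le_of_norm_le_const (C := 1) (by simp) fun t _ => ?_).trans ?_
  · rw [norm_pow, norm_norm]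
    exact pow_le_one₀ (norm_nonneg _) (hb _)
  · simp

theorem KR_sup_le_Sobolev_sup
    {n : ℕ} (hn : 0 < n)
    (μ ν : Measure (EuclideanSpace ℝ (Fin n)))
    [IsProbabilityMeasure μ] [IsProbabilityMeasure ν]
    (A B : Set ℝ)
    (hA : A = {r : ℝ | ∃ f : EuclideanSpace ℝ (Fin n) → ℝ,
      Differentiable ℝ f ∧
      (∀ u v : EuclideanSpace ℝ (Fin n), |f u - f v| ≤ ‖u - v‖) ∧
      Integrable f μ ∧ Integrable f ν ∧
      r = (∫ x, f x ∂μ) - ∫ x, f x ∂ν})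
    (hB : B = {r : ℝ | ∃ f : EuclideanSpace ℝ (Fin n) → ℝ,
      ContDiff ℝ 1 f ∧
      Integrable f μ ∧ Integrable f ν ∧
      (∀ x ∈ measureSupport μ, ∀ y ∈ measureSupport ν, SobolevLineConstraint f x y) ∧
      r = (∫ x, f x ∂μ) - ∫ x, f x ∂ν})
    (hBdd : BddAbove B) :
    sSup A ≤ sSup B := by
  have hA0 : A.Nonempty := by
    refine ⟨0, ?_⟩
    rw [hA]
    exact ⟨fun _ => 0, by fun_prop, by simp, by simp, by simp, by simp⟩
  refine csSup_le hA0 fun r hr => ?_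
  rw [hA] at hr
  obtain ⟨f, hfd, hf, hfμ, hfν, rfl⟩ := hr
  refine le_of_forall_pos_le_add fun ε hε => ?_
  obtain ⟨g, hgc, hg, hgf⟩ := exists_smooth_approx f hf (ε / 2) (by linarith)
  have key : ∀ (ρ : Measure (EuclideanSpace ℝ (Fin n))) [IsProbabilityMeasure ρ],
      Integrable f ρ → Integrable g ρ ∧ |(∫ x, g x ∂ρ) - ∫ x, f x ∂ρ| ≤ ε / 2 := by
    intro ρ _ hfρ
    have hd : Integrable (fun x => g x - f x) ρ :=
      Integrable.of_bound (hgc.continuous.sub hfd.continuous).aestronglyMeasurable (ε / 2)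
        (Filter.Eventually.of_forall fun x => hgf x)
    have hgi : Integrable g ρ := by
      have := hd.add hfρ
      refine this.congr (Filter.Eventually.of_forall fun x => ?_)
      simp
    refine ⟨hgi, ?_⟩
    rw [← integral_sub hgi hfρ, ← Real.norm_eq_abs]
    have := norm_integral_le_of_norm_le_const (μ := ρ) (f := fun x => g x - f x) (C := ε / 2)
      (Filter.Eventually.of_forall fun x => hgf x)
    simpa using this
  obtain ⟨hgμ, h1⟩ := key μ hfμ
  obtain ⟨hgν, h2⟩ := key ν hfν
  have hmem : (∫ x, g x ∂μ) - ∫ x, g x ∂ν ∈ B := by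
    rw [hB]
    exact ⟨g, hgc, hgμ, hgν, fun x _ y _ => sobolev_of_lipschitz g hg x y, rfl⟩
  have h3 := le_csSup hBdd hmem
  rw [abs_le] at h1 h2
  linarith [h1.1, h2.2]
end

section
/- Let n be a positive natural number, E = EuclideanSpace ℝ (Fin n), let μ and ν be probability measures on E, and let f : E → ℝ be continuously differentiable, integrable with respect to both μ and ν, and satisfy the Sobolev line constraint at (x, y) for every x in the support of μ and every y in the support of ν. Then for every coupling π of μ and ν such that (x, y) ↦ ‖x − y‖ is π-integrable, we have ∫ f dμ − ∫ f dν ≤ ∫ ‖x − y‖ dπ(x, y). -/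
open MeasureTheory

/-- `π` is a coupling of `μ` and `ν`: its marginals are `μ` and `ν`. -/
def IsCoupling {n : ℕ} (μ ν : Measure (EuclideanSpace ℝ (Fin n)))
    (π : Measure (EuclideanSpace ℝ (Fin n) × EuclideanSpace ℝ (Fin n))) : Prop :=
  π.map Prod.fst = μ ∧ π.map Prod.snd = ν

lemma pointwise_bound {n : ℕ} (f : EuclideanSpace ℝ (Fin n) → ℝ)
    (hf : ContDiff ℝ 1 f) (x y : EuclideanSpace ℝ (Fin n))
    (h : SobolevLineConstraint f x y) : f x - f y ≤ ‖x - y‖ := by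
  have hgc : Continuous (gradient f) := by
    unfold gradient
    exact (LinearIsometryEquiv.continuous _).comp (hf.continuous_fderiv one_ne_zero)
  set γ : ℝ → EuclideanSpace ℝ (Fin n) := fun t => t • x + (1 - t) • y with hγ
  have hγc : Continuous γ := by fun_prop
  have hγd : ∀ t, HasDerivAt γ (x - y) t := by
    intro t
    have h1 : HasDerivAt (fun t : ℝ => t • x) ((1 : ℝ) • x) t :=
      (hasDerivAt_id t).smul_const x
    have h2 : HasDerivAt (fun t : ℝ => (1 - t) • y) ((-1 : ℝ) • y) t :=
      ((hasDerivAt_id t).const_sub 1).smul_const y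
    have h3 := h1.add h2
    have e : (1 : ℝ) • x + (-1 : ℝ) • y = x - y := by
      rw [one_smul, neg_one_smul, sub_eq_add_neg]
    rw [e] at h3
    exact h3
  have hd : ∀ t, HasDerivAt (fun t => f (γ t)) (inner ℝ (gradient f (γ t)) (x - y)) t := by
    intro t
    have hfd : HasFDerivAt f (fderiv ℝ f (γ t)) (γ t) :=
      ((hf.differentiable one_ne_zero) (γ t)).hasFDerivAt
    have h3 := hfd.comp_hasDerivAt t (hγd t)
    have e : inner ℝ (gradient f (γ t)) (x - y) = fderiv ℝ f (γ t) (x - y) := by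
      simp [gradient]
    rw [e]
    exact h3
  have hFTC : ∫ t in (0:ℝ)..1, inner ℝ (gradient f (γ t)) (x - y) = f (γ 1) - f (γ 0) := by
    apply intervalIntegral.integral_eq_sub_of_hasDerivAt (fun t _ => hd t)
    apply Continuous.intervalIntegrable
    fun_prop
  have e1 : γ 1 = x := by simp [hγ]
  have e0 : γ 0 = y := by simp [hγ]
  rw [e1, e0] at hFTC
  have hI : ∫ t in (0:ℝ)..1, ‖gradient f (γ t)‖ ^ 2 ≤ 1 := by
    rw [intervalIntegral.integral_of_le zero_le_one, ← integral_Icc_eq_integral_Ioc]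
    exact h
  have hle : ∫ t in (0:ℝ)..1, inner ℝ (gradient f (γ t)) (x - y) ≤
      ∫ t in (0:ℝ)..1, ((1 + ‖gradient f (γ t)‖ ^ 2) * (‖x - y‖ / 2)) := by
    apply intervalIntegral.integral_mono_on zero_le_one
    · apply Continuous.intervalIntegrable
      fun_prop
    · apply Continuous.intervalIntegrable
      fun_prop
    · intro t _
      have := real_inner_le_norm (gradient f (γ t)) (x - y)
      nlinarith [mul_nonneg (sq_nonneg (‖gradient f (γ t)‖ - 1)) (norm_nonneg (x - y))]
  rw [intervalIntegral.integral_mul_const, intervalIntegral.integral_add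
    (by simp) (Continuous.intervalIntegrable (by fun_prop) _ _)] at hle
  simp only [intervalIntegral.integral_const, sub_zero, smul_eq_mul, mul_one] at hle
  nlinarith [norm_nonneg (x - y)]

lemma ae_mem_measureSupport {n : ℕ} (μ : Measure (EuclideanSpace ℝ (Fin n))) :
    ∀ᵐ x ∂μ, x ∈ measureSupport μ := by
  have h : μ.support ∈ ae μ := Measure.support_mem_ae
  filter_upwards [h] with x hx U hU
  exact ((Measure.mem_support_iff_forall x).1 hx U hU).ne'

theorem sobolev_constrained_integral_diff_le_transport_cost
    {n : ℕ} (hn : 0 < n)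
    (μ ν : Measure (EuclideanSpace ℝ (Fin n)))
    [IsProbabilityMeasure μ] [IsProbabilityMeasure ν]
    (f : EuclideanSpace ℝ (Fin n) → ℝ)
    (hf : ContDiff ℝ 1 f)
    (hμint : Integrable f μ) (hνint : Integrable f ν)
    (hS : ∀ x ∈ measureSupport μ, ∀ y ∈ measureSupport ν, SobolevLineConstraint f x y) :
    ∀ π : Measure (EuclideanSpace ℝ (Fin n) × EuclideanSpace ℝ (Fin n)),
      IsCoupling μ ν π →
      Integrable (fun p : EuclideanSpace ℝ (Fin n) × EuclideanSpace ℝ (Fin n) =>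
        ‖p.1 - p.2‖) π →
      (∫ x, f x ∂μ) - (∫ y, f y ∂ν) ≤
        ∫ p : EuclideanSpace ℝ (Fin n) × EuclideanSpace ℝ (Fin n), ‖p.1 - p.2‖ ∂π := by
  rintro π ⟨rfl, rfl⟩ hint
  have m1 : AEMeasurable Prod.fst π := measurable_fst.aemeasurable
  have m2 : AEMeasurable Prod.snd π := measurable_snd.aemeasurable
  have i1 : Integrable (fun p => f p.1) π := hμint.comp_aemeasurable m1
  have i2 : Integrable (fun p => f p.2) π := hνint.comp_aemeasurable m2
  rw [integral_map m1 hμint.aestronglyMeasurable, integral_map m2 hνint.aestronglyMeasurable,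
    ← integral_sub i1 i2]
  apply integral_mono_ae (i1.sub i2) hint
  filter_upwards [ae_of_ae_map m1 (ae_mem_measureSupport (π.map Prod.fst)),
    ae_of_ae_map m2 (ae_mem_measureSupport (π.map Prod.snd))] with p h1 h2
  exact pointwise_bound f hf p.1 p.2 (hS _ h1 _ h2)
end

section
/- Let n be a positive natural number, E = EuclideanSpace ℝ (Fin n), let f : E → ℝ be continuously differentiable, and let x, y ∈ E with x ≠ y. Suppose f satisfies the Sobolev line constraint at (x, y), i.e. ∫_{t ∈ [0,1]} ‖∇f(t • x + (1 − t) • y)‖² dt ≤ 1, and that f(x) − f(y) = ‖x − y‖. Then for every t ∈ [0,1], ∇f(t • x + (1 − t) • y) = (x − y) / ‖x − y‖. -/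
open MeasureTheory

theorem gradient_of_saturating_sobolev_critic
    {n : ℕ} (hn : 0 < n)
    (f : EuclideanSpace ℝ (Fin n) → ℝ) (hf : ContDiff ℝ 1 f)
    (x y : EuclideanSpace ℝ (Fin n)) (hxy : x ≠ y)
    (hS : SobolevLineConstraint f x y)
    (heq : f x - f y = ‖x - y‖) :
    ∀ t ∈ Set.Icc (0 : ℝ) 1,
      gradient f (t • x + (1 - t) • y) = ‖x - y‖⁻¹ • (x - y) := by
  have hd : Differentiable ℝ f := hf.differentiable (by norm_num)
  have hnorm : ‖x - y‖ ≠ 0 := norm_ne_zero_iff.mpr (sub_ne_zero.mpr hxy)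
  set u : EuclideanSpace ℝ (Fin n) := ‖x - y‖⁻¹ • (x - y) with hu
  have hu1 : ‖u‖ = 1 := by
    rw [hu, norm_smul, norm_inv, norm_norm, inv_mul_cancel₀ hnorm]
  have hcg : Continuous (fun t : ℝ => gradient f (t • x + (1 - t) • y)) := by
    have h1 : Continuous (gradient f) := by
      unfold gradient
      exact (LinearIsometryEquiv.continuous _).comp (hf.continuous_fderiv (by norm_num))
    exact h1.comp (by fun_prop)
  set g : ℝ → EuclideanSpace ℝ (Fin n) := fun t => gradient f (t • x + (1 - t) • y) with hg
  have hci : Continuous (fun t => inner ℝ (g t) u) := hcg.inner continuous_const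
  have hder : ∀ t : ℝ, HasDerivAt (fun t : ℝ => f (t • x + (1 - t) • y))
      (inner ℝ (g t) (x - y)) t := by
    intro t
    have h1 : HasDerivAt (fun t : ℝ => t • x + (1 - t) • y) (x - y) t := by
      have h2 := ((hasDerivAt_id t).smul_const x).add
        (((hasDerivAt_id t).const_sub 1).smul_const y)
      have h4 : (1 : ℝ) • x + (-1 : ℝ) • y = x - y := by
        rw [one_smul, neg_one_smul, sub_eq_add_neg]
      rw [h4] at h2
      exact h2
    have h3 := ((hd (t • x + (1 - t) • y)).hasFDerivAt).comp_hasDerivAt t h1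
    have h5 : inner ℝ (g t) (x - y) = (fderiv ℝ f (t • x + (1 - t) • y)) (x - y) :=
      InnerProductSpace.toDual_symm_apply
    rw [h5]
    exact h3
  have hftc : ∫ t in (0 : ℝ)..1, inner ℝ (g t) (x - y) = ‖x - y‖ := by
    rw [intervalIntegral.integral_eq_sub_of_hasDerivAt (fun t _ => hder t)
      ((hcg.inner continuous_const).intervalIntegrable _ _)]
    simpa using heq
  have hiu : ∫ t in (0 : ℝ)..1, inner ℝ (g t) u = 1 := by
    simp only [hu, inner_smul_right]
    rw [intervalIntegral.integral_const_mul, hftc, inv_mul_cancel₀ hnorm]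
  have hS' : ∫ t in (0 : ℝ)..1, ‖g t‖ ^ 2 ≤ 1 := by
    rw [intervalIntegral.integral_of_le zero_le_one, ← integral_Icc_eq_integral_Ioc]
    exact hS
  have hle : ∫ t in (0 : ℝ)..1, ‖g t - u‖ ^ 2 ≤ 0 := by
    have he : ∀ t, ‖g t - u‖ ^ 2 = ‖g t‖ ^ 2 - 2 * inner ℝ (g t) u + 1 := by
      intro t
      rw [norm_sub_sq_real, hu1]; norm_num
    have c1 : Continuous (fun t => ‖g t‖ ^ 2) := hcg.norm.pow 2
    have c2 : Continuous (fun t => 2 * inner ℝ (g t) u) := continuous_const.mul hci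
    have c3 : Continuous (fun t => ‖g t‖ ^ 2 - 2 * inner ℝ (g t) u) := c1.sub c2
    simp only [he]
    rw [intervalIntegral.integral_add (c3.intervalIntegrable _ _)
      (continuous_const.intervalIntegrable _ _),
      intervalIntegral.integral_sub (c1.intervalIntegrable _ _) (c2.intervalIntegrable _ _),
      intervalIntegral.integral_const_mul, hiu]
    simp
    linarith
  intro t ht
  by_contra hne
  have hpos : 0 < ∫ t in (0 : ℝ)..1, ‖g t - u‖ ^ 2 := by
    refine intervalIntegral.integral_pos zero_lt_one
      ((hcg.sub continuous_const).norm.pow 2).continuousOn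
      (fun _ _ => by positivity) ⟨t, ht, ?_⟩
    have : 0 < ‖g t - u‖ := norm_pos_iff.mpr (sub_ne_zero.mpr hne)
    positivity
  linarith
end
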